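/- Absence of the No Show Paradox (tie-break case): let candidate A have counts (p_A, n_A) and candidate B have counts (p_B, n_B) with (S(p_A, n_A), T(p_A, n_A)) ≥ (S(p_B, n_B), T(p_B, n_B)) in the lexicographic order. If one additional ballot is added that assigns A a grade strictly greater than the grade it assigns B, then after updating both candidates' counts according to this ballot, the score pair of A is strictly greater than the score pair of B in the lexicographic order. -/

import Mathlib

/-- The three grades of Majority Judgement, with `negative < neutral < positive`. -/
inductive Grade : Type
  | negative
  | neutral
  | positive
  deriving DecidableEq

/-- Numerical encoding of the grades, respecting their order. -/
def Grade.toNat : Grade → ℕ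
  | .negative => 0
  | .neutral => 1
  | .positive => 2

instance : LinearOrder Grade :=
  LinearOrder.lift' Grade.toNat
    (by intro a b h; cases a <;> cases b <;> simp_all [Grade.toNat])

/-- Raw score of Majority Judgement with three grades: `p` positive votes,
`n` negative votes. -/
def S (p n : ℕ) : ℤ := if p > n then (p : ℤ) else -(n : ℤ)

/-- Tie-breaking score, dual to the raw score. -/
def T (p n : ℕ) : ℤ := if p > n then -(n : ℤ) else (p : ℤ)

/-- Updating the vote counts `(p, n)` of a candidate by one additional ballot
assigning the grade `g` to that candidate. -/
def update (g : Grade) (pn : ℕ × ℕ) : ℕ × ℕ :=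
  match g with
  | .positive => (pn.1 + 1, pn.2)
  | .negative => (pn.1, pn.2 + 1)
  | .neutral => pn

/-- A further positive vote strictly increases the score pair. -/
theorem score_lt_update_positive (p n : ℕ) :
    toLex (S p n, T p n) < toLex (S (p + 1) n, T (p + 1) n) := by
  simp only [Prod.Lex.toLex_lt_toLex, S, T]
  split_ifs <;> omega

/-- A further negative vote strictly decreases the score pair. -/
theorem score_update_negative_lt (p n : ℕ) :
    toLex (S p (n + 1), T p (n + 1)) < toLex (S p n, T p n) := by
  simp only [Prod.Lex.toLex_lt_toLex, S, T]
  split_ifs <;> omega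

/-- Absence of the No Show Paradox, tie-break case: if A's score pair is at
least B's score pair in the lexicographic order and an additional ballot
grades A strictly better than B, then after the ballot A's score pair is
strictly greater than B's in the lexicographic order. -/
theorem no_show_paradox_tie_break (pA nA pB nB : ℕ) (gA gB : Grade)
    (hS : toLex (S pB nB, T pB nB) ≤ toLex (S pA nA, T pA nA)) (hg : gB < gA) :
    toLex (S (update gB (pB, nB)).1 (update gB (pB, nB)).2,
        T (update gB (pB, nB)).1 (update gB (pB, nB)).2) <
      toLex (S (update gA (pA, nA)).1 (update gA (pA, nA)).2,
        T (update gA (pA, nA)).1 (update gA (pA, nA)).2) := by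
  cases gA <;> cases gB <;> first | exact absurd hg (by decide) | skip
  · exact (score_update_negative_lt pB nB).trans_le hS
  · exact ((score_update_negative_lt pB nB).trans_le hS).trans (score_lt_update_positive pA nA)
  · exact hS.trans_lt (score_lt_update_positive pA nA)
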